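/- arXiv:0806.3456 — 2 statements merged into one kernel-verified Lean document; each statement's English description precedes it below -/
import Mathlib

section
/- Let V be a finite set, E ⊆ V × V a finite set of arcs, and w : V × V → ℝ a weight function. If y is an extreme point of the negative-weight flow polyhedron P(G,w), then there do not exist two distinct directed cycles C₁ ≠ C₂ in E with w(C₁) ≠ 0 and w(C₂) ≠ 0 such that y_e > 0 for every arc e ∈ C₁ ∪ C₂. -/
/-- `C` is a directed cycle in the arc set `E`: there are `n ≥ 1` pairwise distinct
vertices `v₀, …, v_{n-1}` with `C = {(v₀,v₁), (v₁,v₂), …, (v_{n-1},v₀)} ⊆ E`. -/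
def IsDirectedCycle {V : Type*} [Fintype V] [DecidableEq V]
    (E : Finset (V × V)) (C : Finset (V × V)) : Prop :=
  ∃ n : ℕ, ∃ f : Fin (n + 1) → V, Function.Injective f ∧
    C = Finset.image (fun i : Fin (n + 1) => (f i, f (i + 1))) Finset.univ ∧ C ⊆ E

/-- The negative-weight flow polyhedron `P(G,w)`: nonnegative circulations supported on
`E` with total weight `-1`. -/
def flowPolyhedron {V : Type*} [Fintype V] [DecidableEq V]
    (E : Finset (V × V)) (w : V × V → ℝ) : Set (V × V → ℝ) :=
  {y | (∀ e, e ∉ E → y e = 0) ∧ (∀ e, 0 ≤ y e) ∧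
    (∀ u : V, ∑ v ∈ Finset.univ.filter (fun v => (u, v) ∈ E), y (u, v)
            = ∑ v ∈ Finset.univ.filter (fun v => (v, u) ∈ E), y (v, u)) ∧
    (∑ e ∈ E, w e * y e) = -1}

/-- The indicator function of a directed cycle satisfies flow conservation. -/
theorem IsDirectedCycle.sum_indicator {V : Type*} [Fintype V] [DecidableEq V]
    {E C : Finset (V × V)} (hC : IsDirectedCycle E C) (u : V) :
    ∑ v, (if (u, v) ∈ C then (1 : ℝ) else 0) = ∑ v, if (v, u) ∈ C then (1 : ℝ) else 0 := by
  obtain ⟨n, f, hf, rfl, -⟩ := hC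
  have key : ∀ e : V × V,
      (if e ∈ Finset.univ.image (fun i : Fin (n + 1) => (f i, f (i + 1))) then (1 : ℝ) else 0)
        = ∑ i : Fin (n + 1), if (f i, f (i + 1)) = e then (1 : ℝ) else 0 := by
    intro e
    split_ifs with h
    · obtain ⟨j, -, rfl⟩ := Finset.mem_image.1 h
      rw [Finset.sum_eq_single j]
      · simp
      · intro i _ hij
        exact if_neg fun hi => hij (hf (Prod.ext_iff.1 hi).1)
      · simp
    · refine (Finset.sum_eq_zero fun i _ => if_neg fun hi => h ?_).symm
      exact Finset.mem_image.2 ⟨i, Finset.mem_univ i, hi⟩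
  simp only [key]
  rw [Finset.sum_comm, Finset.sum_comm (s := (Finset.univ : Finset V))]
  have hout : ∀ i : Fin (n + 1), ∑ v, (if (f i, f (i + 1)) = (u, v) then (1 : ℝ) else 0)
      = if f i = u then 1 else 0 := by
    intro i
    by_cases h : f i = u <;> simp [Prod.ext_iff, h]
  have hin : ∀ i : Fin (n + 1), ∑ v, (if (f i, f (i + 1)) = (v, u) then (1 : ℝ) else 0)
      = if f (i + 1) = u then 1 else 0 := by
    intro i
    by_cases h : f (i + 1) = u <;> simp [Prod.ext_iff, h]
  simp only [hout, hin]
  exact (Equiv.sum_comp (Equiv.addRight (1 : Fin (n + 1)))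
    (fun i => if f i = u then (1 : ℝ) else 0)).symm

/-- For `z` supported on `E`, the sums over arcs of `E` in the flow conservation law may be
taken over all vertices. -/
theorem sum_filter_arcs_eq {V : Type*} [Fintype V] [DecidableEq V] {E : Finset (V × V)}
    {z : V × V → ℝ} (hz : ∀ e, e ∉ E → z e = 0) (g : V → V × V) :
    ∑ v ∈ Finset.univ.filter (fun v => g v ∈ E), z (g v) = ∑ v, z (g v) :=
  Finset.sum_filter_of_ne fun _ _ hv => by_contra fun h => hv (hz _ h)

/-- A circulation of weight zero which vanishes wherever an extreme point of the polyhedron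
vanishes is zero. -/
theorem eq_zero_of_mem_extremePoints_flowPolyhedron {V : Type*} [Fintype V] [DecidableEq V]
    {E : Finset (V × V)} {w y z : V × V → ℝ}
    (hy : y ∈ Set.extremePoints ℝ (flowPolyhedron E w))
    (hsupp : ∀ e, y e = 0 → z e = 0)
    (hflow : ∀ u, ∑ v, z (u, v) = ∑ v, z (v, u))
    (hw : ∑ e ∈ E, w e * z e = 0) : z = 0 := by
  obtain ⟨⟨hyE, hy0, hyflow, hyw⟩, hext⟩ := hy
  have hzE : ∀ e, e ∉ E → z e = 0 := fun e he => hsupp e (hyE e he)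
  have hev : ∀ᶠ ε : ℝ in nhdsWithin 0 (Set.Ioi 0), ∀ e, ε * |z e| ≤ y e := by
    refine Filter.eventually_all.2 fun e => ?_
    rcases (hy0 e).eq_or_lt with h | h
    · simp [hsupp e h.symm, ← h]
    · have ht : Filter.Tendsto (fun ε : ℝ => ε * |z e|) (nhds 0) (nhds 0) := by
        have hc : Continuous fun ε : ℝ => ε * |z e| := by fun_prop
        simpa using hc.tendsto 0
      exact ((ht.eventually (gt_mem_nhds h)).filter_mono nhdsWithin_le_nhds).mono
        fun _ hε => hε.le
  obtain ⟨ε, hε, hpos⟩ := (hev.and self_mem_nhdsWithin).exists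
  have hpos : 0 < ε := hpos
  have hmem : ∀ c : ℝ, |c| = ε → y + c • z ∈ flowPolyhedron E w := by
    intro c hc
    have hE : ∀ e, e ∉ E → (y + c • z) e = 0 := fun e he => by simp [hyE e he, hzE e he]
    refine ⟨hE, fun e => ?_, fun u => ?_, ?_⟩
    · have h := hε e
      rw [← hc, ← abs_mul] at h
      simpa using (by linarith [neg_abs_le (c * z e)] : 0 ≤ y e + c * z e)
    · have h := hyflow u
      rw [sum_filter_arcs_eq hyE fun v => (u, v), sum_filter_arcs_eq hyE fun v => (v, u)] at h
      rw [sum_filter_arcs_eq hE fun v => (u, v), sum_filter_arcs_eq hE fun v => (v, u)]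
      simp only [Pi.add_apply, Pi.smul_apply, smul_eq_mul, Finset.sum_add_distrib,
        ← Finset.mul_sum, h, hflow u]
    · simp only [Pi.add_apply, Pi.smul_apply, smul_eq_mul, mul_add, Finset.sum_add_distrib,
        mul_left_comm _ c, ← Finset.mul_sum, hw, hyw]
      ring
  have hseg : y ∈ openSegment ℝ (y + ε • z) (y + (-ε) • z) := by
    refine ⟨1 / 2, 1 / 2, by norm_num, by norm_num, by norm_num, ?_⟩
    module
  have heq := hext (hmem ε (abs_of_pos hpos)) (hmem (-ε) (by rw [abs_neg, abs_of_pos hpos])) hseg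
  exact (smul_eq_zero.1 (add_eq_left.1 heq)).resolve_left (ne_of_gt hpos)


/-- If `y` is an extreme point of `P(G,w)`, then there do not exist
two distinct directed cycles `C₁ ≠ C₂` in `E`, each of nonzero weight, with `y_e > 0`
for every arc `e ∈ C₁ ∪ C₂`. -/
theorem extremePoint_no_two_cycles {V : Type*} [Fintype V] [DecidableEq V]
    (E : Finset (V × V)) (w : V × V → ℝ)
    (y : V × V → ℝ) (hy : y ∈ Set.extremePoints ℝ (flowPolyhedron E w)) :
    ¬ ∃ C₁ C₂ : Finset (V × V), C₁ ≠ C₂ ∧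
        IsDirectedCycle E C₁ ∧ IsDirectedCycle E C₂ ∧
        (∑ e ∈ C₁, w e) ≠ 0 ∧ (∑ e ∈ C₂, w e) ≠ 0 ∧
        ∀ e ∈ C₁ ∪ C₂, 0 < y e := by
  rintro ⟨C₁, C₂, hne, hC₁, hC₂, hw₁, hw₂, hpos⟩
  have hsub : ∀ {C : Finset (V × V)}, IsDirectedCycle E C → C ⊆ E := by
    rintro C ⟨_, _, _, _, h⟩
    exact h
  have hweight : ∀ {C : Finset (V × V)}, C ⊆ E →
      ∑ e ∈ E, w e * (if e ∈ C then (1 : ℝ) else 0) = ∑ e ∈ C, w e := by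
    intro C hC
    simp only [mul_ite, mul_one, mul_zero, ← Finset.sum_filter, Finset.filter_mem_eq_inter,
      Finset.inter_eq_right.2 hC]
  have hz := eq_zero_of_mem_extremePoints_flowPolyhedron
    (z := fun e => (∑ e ∈ C₂, w e) * (if e ∈ C₁ then 1 else 0)
      - (∑ e ∈ C₁, w e) * (if e ∈ C₂ then 1 else 0)) hy ?_ ?_ ?_
  · refine hne (Finset.ext fun e => ?_)
    have he := congrFun hz e
    by_cases h₁ : e ∈ C₁ <;> by_cases h₂ : e ∈ C₂ <;> simp_all
  · intro e he
    have h₁ : e ∉ C₁ := fun h => (hpos e (Finset.mem_union_left _ h)).ne' he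
    have h₂ : e ∉ C₂ := fun h => (hpos e (Finset.mem_union_right _ h)).ne' he
    simp [h₁, h₂]
  · intro u
    simp only [Finset.sum_sub_distrib, ← Finset.mul_sum, hC₁.sum_indicator u,
      hC₂.sum_indicator u]
  · simp only [mul_sub, Finset.sum_sub_distrib, mul_left_comm (w _), ← Finset.mul_sum,
      hweight (hsub hC₁), hweight (hsub hC₂)]
    ring
end

section
/- Let V be a finite set, E ⊆ V × V a finite set of arcs, and w : V × V → ℝ a weight function. If y is an extreme point of the negative-weight flow polyhedron P(G,w), then there exists a directed cycle C in E with w(C) < 0 such that the support {e : y_e > 0} of y equals C and y = (−1/w(C)) · χ(C). -/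
open Filter Topology in
/-- A vector vanishing off the support of a nonnegative `y` can be scaled down below `y`. -/
theorem exists_pos_mul_abs_le {ι : Type*} [Finite ι] {y g : ι → ℝ} (hy : ∀ e, 0 ≤ y e)
    (hg : ∀ e, y e = 0 → g e = 0) : ∃ ε : ℝ, 0 < ε ∧ ∀ e, ε * |g e| ≤ y e := by
  have h : ∀ᶠ ε : ℝ in 𝓝[>] 0, ∀ e, ε * |g e| ≤ y e := by
    rw [eventually_all]
    intro e
    rcases (hy e).eq_or_lt with h0 | h0
    · simp [hg e h0.symm, ← h0]
    · have ht : Tendsto (fun ε : ℝ => ε * |g e|) (𝓝 0) (𝓝 0) := by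
        simpa using (continuous_mul_const |g e|).tendsto 0
      exact ((ht.eventually_lt_const h0).filter_mono nhdsWithin_le_nhds).mono fun _ h => h.le
  obtain ⟨ε, h1, h2⟩ := (h.and self_mem_nhdsWithin).exists
  exact ⟨ε, h2, h1⟩

/-- A weight-zero circulation whose support lies in that of an extreme point vanishes. -/
theorem circulation_eq_zero_of_mem_extremePoints {V : Type*} [Fintype V] [DecidableEq V]
    {E : Finset (V × V)} {w y g : V × V → ℝ}
    (hy : y ∈ Set.extremePoints ℝ (flowPolyhedron E w))
    (hsupp : ∀ e, y e = 0 → g e = 0)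
    (hcons : ∀ u : V, ∑ v ∈ Finset.univ.filter (fun v => (u, v) ∈ E), g (u, v)
            = ∑ v ∈ Finset.univ.filter (fun v => (v, u) ∈ E), g (v, u))
    (hw : ∑ e ∈ E, w e * g e = 0) : g = 0 := by
  rw [mem_extremePoints] at hy
  obtain ⟨⟨hyE, hy0, hyc, hyw⟩, hext⟩ := hy
  obtain ⟨ε, hε, hle⟩ := exists_pos_mul_abs_le hy0 hsupp
  have key : ∀ c : ℝ, |c| = ε → y + c • g ∈ flowPolyhedron E w := by
    intro c hc
    refine ⟨fun e he => ?_, fun e => ?_, fun u => ?_, ?_⟩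
    · simp [hyE e he, hsupp e (hyE e he)]
    · have h1 := hle e
      rw [← hc, ← abs_mul] at h1
      have h2 := neg_abs_le (c * g e)
      simp only [Pi.add_apply, Pi.smul_apply, smul_eq_mul]
      linarith
    · simp only [Pi.add_apply, Pi.smul_apply, smul_eq_mul, Finset.sum_add_distrib,
        ← Finset.mul_sum, hyc u, hcons u]
    · simp only [Pi.add_apply, Pi.smul_apply, smul_eq_mul, mul_add, Finset.sum_add_distrib,
        mul_left_comm _ c, ← Finset.mul_sum, hyw, hw, mul_zero, add_zero]
  have h := (hext _ (key ε (abs_of_pos hε)) _ (key (-ε) (by rw [abs_neg, abs_of_pos hε]))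
    ⟨1 / 2, 1 / 2, by norm_num, by norm_num, by norm_num, by module⟩).1
  simpa [hε.ne'] using h

/-- A self-map of a finite type maps some iterate of any point to a periodic point. -/
theorem exists_iterate_mem_periodicPts {α : Type*} [Finite α] (s : α → α) (x : α) :
    ∃ i, s^[i] x ∈ Function.periodicPts s := by
  obtain ⟨i, j, hij, h⟩ := Finite.exists_ne_map_eq_of_infinite fun i : ℕ => s^[i] x
  wlog hlt : i < j generalizing i j
  · exact this j i hij.symm h.symm (by omega)
  refine ⟨i, Function.mk_mem_periodicPts (n := j - i) (by omega) ?_⟩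
  rw [Function.IsPeriodicPt, Function.IsFixedPt, ← Function.iterate_add_apply,
    Nat.sub_add_cancel hlt.le]
  exact h.symm

/-- The orbit of a periodic point, enumerated injectively and cyclically. -/
theorem exists_injective_cyclic_orbit {α : Type*} {s : α → α} {x : α}
    (hx : x ∈ Function.periodicPts s) :
    ∃ n : ℕ, ∃ f : Fin (n + 1) → α, Function.Injective f ∧ (∀ i, f (i + 1) = s (f i)) ∧
      ∀ i, ∃ k, f i = s^[k] x := by
  obtain ⟨n, hn⟩ := Nat.exists_eq_add_of_lt (Function.minimalPeriod_pos_of_mem_periodicPts hx)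
  rw [zero_add] at hn
  refine ⟨n, fun i => s^[i] x, fun i j hij => ?_, fun i => ?_, fun i => ⟨i, rfl⟩⟩
  · exact Fin.ext (Function.iterate_injOn_Iio_minimalPeriod (f := s) (x := x)
      (i.isLt.trans_eq hn.symm) (j.isLt.trans_eq hn.symm) hij)
  · simp only
    rw [← Function.iterate_succ_apply' s, Fin.val_add_one]
    split_ifs with h
    · subst h
      have := Function.iterate_minimalPeriod (f := s) (x := x)
      rw [hn] at this
      simpa using this.symm
    · rfl

/-- A relation on a finite type that can always be continued contains a cycle. -/
theorem exists_injective_cycle {α : Type*} [Finite α] {r : α → α → Prop}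
    (hr : ∀ a b, r a b → ∃ c, r b c) {a b : α} (hab : r a b) :
    ∃ n : ℕ, ∃ f : Fin (n + 1) → α, Function.Injective f ∧ ∀ i, r (f i) (f (i + 1)) := by
  classical
  let s : α → α := fun a => if h : ∃ b, r a b then h.choose else a
  have hs : ∀ a, (∃ b, r a b) → r a (s a) := fun a h => by
    simp only [s, dif_pos h]
    exact h.choose_spec
  have hit : ∀ k, ∃ c, r (s^[k] a) c := by
    intro k
    induction k with
    | zero => exact ⟨b, hab⟩
    | succ k ih =>
      rw [Function.iterate_succ_apply']
      exact hr _ _ (hs _ ih)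
  obtain ⟨i, hi⟩ := exists_iterate_mem_periodicPts s a
  obtain ⟨n, f, hf, hstep, horb⟩ := exists_injective_cyclic_orbit hi
  refine ⟨n, f, hf, fun j => ?_⟩
  rw [hstep]
  obtain ⟨k, hk⟩ := horb j
  apply hs
  rw [hk, ← Function.iterate_add_apply]
  exact hit _

/-- The support of a nonzero nonnegative circulation contains a directed cycle. -/
theorem exists_isDirectedCycle_pos {V : Type*} [Fintype V] [DecidableEq V]
    {E : Finset (V × V)} {y : V × V → ℝ}
    (hyE : ∀ e, e ∉ E → y e = 0) (hy0 : ∀ e, 0 ≤ y e)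
    (hyc : ∀ u : V, ∑ v ∈ Finset.univ.filter (fun v => (u, v) ∈ E), y (u, v)
            = ∑ v ∈ Finset.univ.filter (fun v => (v, u) ∈ E), y (v, u))
    (hne : y ≠ 0) : ∃ C, IsDirectedCycle E C ∧ ∀ e ∈ C, 0 < y e := by
  have hmem : ∀ e, 0 < y e → e ∈ E := fun e he => by
    by_contra h
    exact he.ne' (hyE e h)
  have hr : ∀ a b, 0 < y (a, b) → ∃ c, 0 < y (b, c) := by
    intro a b hab
    have hpos : 0 < ∑ v ∈ Finset.univ.filter (fun v => (v, b) ∈ E), y (v, b) :=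
      Finset.sum_pos' (fun _ _ => hy0 _) ⟨a, by simpa using hmem _ hab, hab⟩
    rw [← hyc b] at hpos
    obtain ⟨c, -, hc⟩ := Finset.exists_lt_of_sum_lt (f := fun _ => (0 : ℝ)) (by simpa using hpos)
    exact ⟨c, hc⟩
  obtain ⟨⟨a, b⟩, hab⟩ := Function.ne_iff.mp hne
  obtain ⟨n, f, hf, hstep⟩ := exists_injective_cycle (r := fun a b => 0 < y (a, b)) hr
    (lt_of_le_of_ne (hy0 (a, b)) (Ne.symm hab))
  have hpos : ∀ e ∈ Finset.image (fun i => (f i, f (i + 1))) Finset.univ, 0 < y e := by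
    simpa using hstep
  exact ⟨_, ⟨n, f, hf, rfl, fun e he => hmem e (hpos e he)⟩, hpos⟩

/-- The characteristic vector of a directed cycle is a circulation. -/
theorem IsDirectedCycle.sum_indicator_eq {V : Type*} [Fintype V] [DecidableEq V]
    {E C : Finset (V × V)} (hC : IsDirectedCycle E C) (u : V) :
    ∑ v ∈ Finset.univ.filter (fun v => (u, v) ∈ E), (if (u, v) ∈ C then (1 : ℝ) else 0)
      = ∑ v ∈ Finset.univ.filter (fun v => (v, u) ∈ E),
          (if (v, u) ∈ C then (1 : ℝ) else 0) := by
  obtain ⟨n, f, hf, hCf, hCE⟩ := hC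
  have hχ : ∀ e, (if e ∈ C then (1 : ℝ) else 0)
      = ∑ i, if (f i, f (i + 1)) = e then (1 : ℝ) else 0 := by
    intro e
    have hinj : Function.Injective fun i => (f i, f (i + 1)) :=
      fun i j h => hf (congrArg Prod.fst h)
    rw [← Finset.sum_ite_eq' C e fun _ => (1 : ℝ), hCf, Finset.sum_image hinj.injOn]
  have hout : ∀ v, (u, v) ∉ E → (if (u, v) ∈ C then (1 : ℝ) else 0) = 0 :=
    fun v h => if_neg fun h' => h (hCE h')
  have hin : ∀ v, (v, u) ∉ E → (if (v, u) ∈ C then (1 : ℝ) else 0) = 0 :=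
    fun v h => if_neg fun h' => h (hCE h')
  rw [Finset.sum_filter_of_ne fun v _ h => not_imp_comm.mp (hout v) h,
    Finset.sum_filter_of_ne fun v _ h => not_imp_comm.mp (hin v) h]
  simp only [hχ]
  rw [Finset.sum_comm, Finset.sum_comm (s := Finset.univ (α := V))]
  simp only [Prod.mk.injEq, ite_and, Finset.sum_ite_irrel, Finset.sum_const_zero,
    Finset.sum_ite_eq, Finset.mem_univ, if_true]
  exact (Equiv.sum_comp (Equiv.addRight (1 : Fin (n + 1))) fun i =>
    if f i = u then (1 : ℝ) else 0).symm

/-- If `y` is an extreme point of `P(G,w)`, then there is a directed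
cycle `C` in `E` with `w(C) < 0` such that the support of `y` is exactly `C` and
`y = (−1/w(C)) · χ(C)`. -/
theorem extremePoint_eq_scaled_cycle {V : Type*} [Fintype V] [DecidableEq V]
    (E : Finset (V × V)) (w : V × V → ℝ)
    (y : V × V → ℝ) (hy : y ∈ Set.extremePoints ℝ (flowPolyhedron E w)) :
    ∃ C : Finset (V × V), IsDirectedCycle E C ∧ (∑ e ∈ C, w e) < 0 ∧
      {e : V × V | 0 < y e} = (C : Set (V × V)) ∧
      y = (-(∑ e ∈ C, w e))⁻¹ • (fun e => if e ∈ C then (1 : ℝ) else 0) := by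
  obtain ⟨hyE, hy0, hyc, hyw⟩ := hy.1
  have hne : y ≠ 0 := by
    rintro rfl
    simp at hyw
  obtain ⟨C, hC, hpos⟩ := exists_isDirectedCycle_pos hyE hy0 hyc hne
  have hCE : C ⊆ E := by
    obtain ⟨_, _, _, _, h⟩ := hC
    exact h
  have hCne : C.Nonempty := by
    obtain ⟨_, _, _, h, _⟩ := hC
    simp [h]
  have hχw : ∑ e ∈ E, w e * (if e ∈ C then (1 : ℝ) else 0) = ∑ e ∈ C, w e := by
    simp only [mul_ite, mul_one, mul_zero]
    rw [Finset.sum_ite_mem, Finset.inter_eq_right.mpr hCE]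
  have hzero := circulation_eq_zero_of_mem_extremePoints hy
    (g := fun e => (if e ∈ C then (1 : ℝ) else 0) + (∑ e ∈ C, w e) * y e)
    (fun e he => by simp [he, show e ∉ C from fun h => (hpos e h).ne' he])
    (fun u => by
      simp only [Finset.sum_add_distrib, ← Finset.mul_sum, hyc u, hC.sum_indicator_eq u])
    (by
      simp only [mul_add, Finset.sum_add_distrib, mul_left_comm _ (∑ e ∈ C, w e),
        ← Finset.mul_sum, hyw, hχw]
      ring)
  refine ⟨C, hC, ?_⟩
  generalize ∑ e ∈ C, w e = W at hzero ⊢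
  have hval : ∀ e, (if e ∈ C then (1 : ℝ) else 0) + W * y e = 0 := congrFun hzero
  have hW : W < 0 := by
    obtain ⟨e, he⟩ := hCne
    have h := hval e
    rw [if_pos he] at h
    by_contra! hW
    linarith [mul_nonneg hW (hy0 e)]
  refine ⟨hW, ?_, ?_⟩
  · ext e
    refine ⟨fun he => ?_, hpos e⟩
    by_contra h
    have h' := hval e
    rw [if_neg (mt Finset.mem_coe.mpr h), zero_add] at h'
    exact (mul_neg_of_neg_of_pos hW he).ne h'
  · ext e
    rw [Pi.smul_apply, smul_eq_mul, eq_inv_mul_iff_mul_eq₀ (neg_ne_zero.mpr hW.ne)]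
    linarith [hval e]
end
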